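/- arXiv:1703.03984 — 2 statements merged into one kernel-verified Lean document; each statement's English description precedes it below -/
import Mathlib

section
/- Let G be a connected graph of order n ≥ 3. Then sdiam_{n−1}(G) = n − 1 if and only if G contains at least one cut vertex. -/
open SimpleGraph

/-- The Steiner distance of a vertex set `S` in `G`: the minimum number of edges of a
connected subgraph of `G` whose vertex set contains `S` (`⊤` if no such subgraph exists). -/
noncomputable def steinerDist {V : Type*} (G : SimpleGraph V) (S : Set V) : ℕ∞ :=
  sInf {m : ℕ∞ | ∃ H : G.Subgraph, H.Connected ∧ S ⊆ H.verts ∧ m = H.edgeSet.ncard}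

/-- The Steiner `k`-diameter of `G`: the maximum of `steinerDist G S` over all
`k`-element vertex subsets `S`. -/
noncomputable def sdiam {V : Type*} (G : SimpleGraph V) (k : ℕ) : ℕ∞ :=
  sSup {m : ℕ∞ | ∃ S : Set V, S.ncard = k ∧ m = steinerDist G S}

/-- `v` is a cut vertex of `G` if deleting `v` disconnects `G`. -/
def IsCutVertex {V : Type*} (G : SimpleGraph V) (v : V) : Prop :=
  ¬ (G.induce ({v}ᶜ : Set V)).Connected

/-- `U` is a vertex cut set of the induced subgraph `G[A]` if `U ⊆ A` and deleting `U`
from `G[A]` leaves a disconnected graph. -/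
def IsCutSetOf {V : Type*} (G : SimpleGraph V) (A U : Set V) : Prop :=
  U ⊆ A ∧ ¬ (G.induce (A \ U)).Connected

/-- The vertex connectivity of the induced subgraph `G[A]`: the minimum size of a set
`U ⊆ A` whose removal disconnects `G[A]` or reduces it to a single vertex. -/
noncomputable def kappaOn {V : Type*} (G : SimpleGraph V) (A : Set V) : ℕ :=
  sInf {m : ℕ | ∃ U : Set V, U ⊆ A ∧ U.ncard = m ∧
    (¬ (G.induce (A \ U)).Connected ∨ (A \ U).ncard = 1)}

/-- The vertex connectivity `κ(G)`. -/
noncomputable def kappa {V : Type*} (G : SimpleGraph V) : ℕ :=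
  kappaOn G Set.univ

/-- A connected subgraph on finitely many vertices has at most one more vertex than edges. -/
theorem SimpleGraph.Subgraph.Connected.ncard_verts_le {V : Type*} [Finite V] {G : SimpleGraph V}
    {H : G.Subgraph} (hH : H.Connected) : H.verts.ncard ≤ H.edgeSet.ncard + 1 := by
  have h := hH.coe.card_vert_le_card_edgeSet_add_one
  rwa [Nat.card_coe_set_eq, Nat.card_coe_set_eq,
    ← Set.ncard_image_of_injective _ (Sym2.map.injective Subtype.val_injective),
    Subgraph.image_coe_edgeSet_coe] at h

/-- If `s` induces a connected graph, a spanning tree of it bounds the Steiner distance of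
every subset of `s`. -/
theorem steinerDist_le_of_induce_connected {V : Type*} [Finite V] {G : SimpleGraph V}
    {S s : Set V} (hs : (G.induce s).Connected) (hS : S ⊆ s) :
    steinerDist G S ≤ (↑(s.ncard - 1) : ℕ∞) := by
  obtain ⟨T, hle, hT⟩ := hs.exists_isTree_le
  refine sInf_le ⟨(toSubgraph T hle).map (Embedding.induce s).toHom, ?_, ?_, ?_⟩
  · let f : T →g ((toSubgraph T hle).map (Embedding.induce s).toHom).coe :=
      { toFun := fun x => ⟨x, x, trivial, rfl⟩
        map_rel' := fun {x y} h => ⟨x, y, h, rfl, rfl⟩ }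
    refine ⟨hT.connected.map f ?_⟩
    rintro ⟨_, x, _, rfl⟩
    exact ⟨x, rfl⟩
  · intro x hx
    exact ⟨⟨x, hS hx⟩, trivial, rfl⟩
  · have hcard : T.edgeSet.ncard + 1 = s.ncard := by
      have := Fintype.ofFinite s
      classical
      have h := hT.card_edgeFinset
      rw [← Set.ncard_coe_finset, coe_edgeFinset] at h
      rw [h, ← Nat.card_eq_fintype_card, Nat.card_coe_set_eq]
    rw [Subgraph.edgeSet_map]
    have hE : (toSubgraph T hle).edgeSet = T.edgeSet := by
      ext e
      induction e with
      | _ a b => rfl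
    have hf : Function.Injective (Embedding.induce (G := G) s).toHom :=
      (Embedding.induce (G := G) s).injective
    rw [hE, Set.ncard_image_of_injective _ (Sym2.map.injective hf), ← hcard, Nat.add_sub_cancel]

/-- If `v` is a cut vertex, every connected subgraph containing all other vertices is spanning. -/
theorem IsCutVertex.le_steinerDist {V : Type*} [Finite V] {G : SimpleGraph V} {v : V}
    (hv : IsCutVertex G v) : (↑(Nat.card V - 1) : ℕ∞) ≤ steinerDist G {v}ᶜ := by
  refine le_sInf ?_
  rintro _ ⟨H, hH, hS, rfl⟩
  have hmem : v ∈ H.verts := by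
    by_contra hvH
    have hverts : H.verts = {v}ᶜ :=
      (Set.subset_compl_singleton_iff.mpr hvH).antisymm hS
    exact hv (hverts ▸ hH.induce_verts)
  have huniv : H.verts = Set.univ := by
    rw [Set.eq_univ_iff_forall]
    intro x
    by_cases hx : x = v
    · exact hx ▸ hmem
    · exact hS hx
  have h := hH.ncard_verts_le
  rw [huniv, Set.ncard_univ] at h
  exact_mod_cast Nat.sub_le_of_le_add h

/-- For a connected graph `G` of order `n ≥ 3`, `sdiam_{n-1}(G) = n - 1`
if and only if `G` contains at least one cut vertex. -/
theorem sdiam_pred_eq_iff_cutVertex {V : Type*} [Fintype V] (G : SimpleGraph V)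
    (hG : G.Connected) (n : ℕ) (hn : Fintype.card V = n) (hn3 : 3 ≤ n) :
    sdiam G (n - 1) = (↑(n - 1) : ℕ∞) ↔ ∃ v : V, IsCutVertex G v := by
  have hcard : Nat.card V = n := by rw [Nat.card_eq_fintype_card, hn]
  constructor
  · intro h
    by_contra! hcut
    have hle : sdiam G (n - 1) ≤ (↑(n - 1 - 1) : ℕ∞) := by
      refine sSup_le ?_
      rintro _ ⟨S, hS, rfl⟩
      have hcompl : Sᶜ.ncard = 1 := by
        have := Set.ncard_add_ncard_compl S
        omega
      obtain ⟨v, hv⟩ := Set.ncard_eq_one.mp hcompl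
      obtain rfl : S = {v}ᶜ := by rw [← hv, compl_compl]
      rw [← hS]
      exact steinerDist_le_of_induce_connected (not_not.mp (hcut v)) subset_rfl
    rw [h] at hle
    have : n - 1 ≤ n - 1 - 1 := by exact_mod_cast hle
    omega
  · rintro ⟨v, hv⟩
    apply le_antisymm
    · refine sSup_le ?_
      rintro _ ⟨S, -, rfl⟩
      have h := steinerDist_le_of_induce_connected
        ((induceUnivIso G).connected_iff.mpr hG) (Set.subset_univ S)
      rwa [Set.ncard_univ, hcard] at h
    · rw [← hcard]
      refine hv.le_steinerDist.trans (le_sSup ⟨{v}ᶜ, ?_, rfl⟩)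
      rw [Set.ncard_compl, Set.ncard_singleton]
end

section
/- Let G be a connected graph of order n ≥ 4. Then sdiam_{n−2}(G) = n − 2 if and only if κ(G) = 2 or G contains exactly one cut vertex. -/
open SimpleGraph

namespace SimpleGraph

variable {V : Type*} {G : SimpleGraph V}

lemma Subgraph.Connected.ncard_verts_le_s11 {H : G.Subgraph} (h : H.Connected) :
    H.verts.ncard ≤ H.edgeSet.ncard + 1 := by
  have h1 := h.coe.card_vert_le_card_edgeSet_add_one
  rwa [← H.image_coe_edgeSet_coe,
    Set.ncard_image_of_injective _ (Sym2.map.injective Subtype.val_injective),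
    ← Nat.card_coe_set_eq, ← Nat.card_coe_set_eq]

lemma exists_connected_subgraph_ncard_edgeSet [Finite V] {W : Set V}
    (hW : (G.induce W).Connected) :
    ∃ H : G.Subgraph, H.Connected ∧ H.verts = W ∧ H.edgeSet.ncard + 1 = W.ncard := by
  have hc := (connected_induce_iff.mp hW).coe
  obtain ⟨T, hT, hTt⟩ := hc.exists_isTree_le
  refine ⟨Subgraph.coeSubgraph (toSubgraph T hT),
    Subgraph.Connected.coeSubgraph _ (hTt.connected.toSubgraph hT), ?_, ?_⟩
  · simp
  · have h2 := (isTree_iff_connected_and_card.mp hTt).2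
    rw [Subgraph.coeSubgraph, Subgraph.edgeSet_map,
      Set.ncard_image_of_injective _ (Sym2.map.injective Subgraph.hom_injective)]
    rw [Nat.card_coe_set_eq, Nat.card_coe_set_eq] at h2
    exact h2

lemma steinerDist_le_iff [Finite V] (S : Set V) (k : ℕ) :
    steinerDist G S ≤ k ↔
      ∃ W : Set V, S ⊆ W ∧ (G.induce W).Connected ∧ W.ncard ≤ k + 1 := by
  constructor
  · intro h
    have h1 : steinerDist G S < (k + 1 : ℕ) := h.trans_lt (by exact_mod_cast Nat.lt_succ_self k)
    obtain ⟨_, ⟨H, hH, hS, rfl⟩, hlt⟩ := sInf_lt_iff.mp h1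
    have := hH.ncard_verts_le_s11
    have hlt : H.edgeSet.ncard < k + 1 := by exact_mod_cast hlt
    exact ⟨H.verts, hS, hH.induce_verts, by omega⟩
  · rintro ⟨W, hS, hW, hk⟩
    obtain ⟨H, hH, rfl, hc⟩ := exists_connected_subgraph_ncard_edgeSet hW
    have hle : steinerDist G S ≤ H.edgeSet.ncard := sInf_le ⟨H, hH, hS, rfl⟩
    refine hle.trans ?_
    have : H.edgeSet.ncard ≤ k := by omega
    exact_mod_cast this

lemma induce_insert_connected {W : Set V} {x y : V} (hW : (G.induce W).Connected)
    (hx : x ∈ W) (hxy : G.Adj x y) : (G.induce (insert y W)).Connected := by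
  have := induce_union_connected hW.preconnected
    (induce_pair_connected_of_adj hxy).preconnected ⟨x, hx, by simp⟩
  rwa [show insert y W = W ∪ {x, y} by ext; grind]

/-- If deleting two vertices leaves a connected graph, so does deleting a suitable one of them. -/
lemma Connected.induce_compl_singleton_or (hG : G.Connected) {u v : V} (huv : u ≠ v)
    (h : (G.induce ({u, v}ᶜ : Set V)).Connected) :
    (G.induce ({u}ᶜ : Set V)).Connected ∨ (G.induce ({v}ᶜ : Set V)).Connected := by
  obtain ⟨w, hw⟩ := h.nonempty
  obtain ⟨p⟩ := hG.preconnected w u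
  obtain ⟨d, -, h1, h2⟩ := p.exists_boundary_dart ({u, v}ᶜ : Set V) hw (by simp)
  have hc := induce_insert_connected h h1 d.adj
  simp only [Set.mem_compl_iff, not_not, Set.mem_insert_iff, Set.mem_singleton_iff] at h2
  rcases h2 with h2 | h2 <;> rw [h2] at hc
  · right
    rwa [show ({v}ᶜ : Set V) = insert u {u, v}ᶜ by ext; grind]
  · left
    rwa [show ({u}ᶜ : Set V) = insert v {u, v}ᶜ by ext; grind]

lemma exists_not_connected_induce_compl_pair [Fintype V] (hV : 4 ≤ Fintype.card V) {u : V}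
    (hu : ¬ (G.induce ({u}ᶜ : Set V)).Connected) :
    ∃ v, u ≠ v ∧ ¬ (G.induce ({u, v}ᶜ : Set V)).Connected := by
  by_contra! hcon
  have : Nontrivial V := Fintype.one_lt_card_iff_nontrivial.mp (by omega)
  obtain ⟨v, hv⟩ := exists_ne u
  have hc := hcon v hv.symm
  have hcard : 1 < ({u, v}ᶜ : Set V).ncard := by
    have h1 := Set.ncard_add_ncard_compl ({u, v} : Set V)
    rw [Set.ncard_pair hv.symm, Nat.card_eq_fintype_card] at h1
    omega
  have : Nontrivial ({u, v}ᶜ : Set V) :=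
    Set.nontrivial_coe_sort.mpr ((Set.one_lt_ncard_iff_nontrivial).mp hcard)
  obtain ⟨a⟩ := hc.nonempty
  obtain ⟨b, hab⟩ := hc.preconnected.exists_adj_of_nontrivial a
  have hab : G.Adj b a := hab.symm
  have ha := a.2
  have hb := b.2
  have hba := hab.ne
  simp only [Set.mem_compl_iff, Set.mem_insert_iff, Set.mem_singleton_iff, not_or] at ha hb
  have hins := induce_insert_connected (hcon a (Ne.symm ha.1))
    (show (b : V) ∈ ({u, (a : V)}ᶜ : Set V) by simp [hb.1, hba]) hab
  refine hu ?_
  rwa [show ({u}ᶜ : Set V) = insert (a : V) {u, (a : V)}ᶜ by ext; grind]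

lemma sdiam_le_iff [Finite V] (k m : ℕ) :
    sdiam G k ≤ m ↔ ∀ S : Set V, S.ncard = k →
      ∃ W : Set V, S ⊆ W ∧ (G.induce W).Connected ∧ W.ncard ≤ m + 1 := by
  simp only [sdiam, sSup_le_iff, Set.mem_ofPred_eq, ← steinerDist_le_iff]
  exact ⟨fun h S hS => h _ ⟨S, hS, rfl⟩, by rintro h _ ⟨S, hS, rfl⟩; exact h S hS⟩

lemma ncard_eq_card_sub_two_iff [Fintype V] {m : ℕ} (hV : Fintype.card V = m + 3) (S : Set V) :
    S.ncard = m + 1 ↔ ∃ u v, u ≠ v ∧ S = {u, v}ᶜ := by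
  have h1 := Set.ncard_add_ncard_compl S
  rw [Nat.card_eq_fintype_card, hV] at h1
  have h2 : S.ncard = m + 1 ↔ Sᶜ.ncard = 2 := by omega
  rw [h2, Set.ncard_eq_two]
  simp only [eq_compl_comm, eq_comm]

lemma sdiam_le_card_sub_three_iff [Fintype V] {m : ℕ} (hV : Fintype.card V = m + 3) :
    sdiam G (m + 1) ≤ m ↔ ∀ u v, u ≠ v → (G.induce ({u, v}ᶜ : Set V)).Connected := by
  rw [sdiam_le_iff]
  constructor
  · intro h u v huv
    have hS := (ncard_eq_card_sub_two_iff hV _).mpr ⟨u, v, huv, rfl⟩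
    obtain ⟨W, hSW, hW, hc⟩ := h _ hS
    rwa [Set.eq_of_subset_of_ncard_le hSW (by omega)]
  · intro h S hS
    obtain ⟨u, v, huv, rfl⟩ := (ncard_eq_card_sub_two_iff hV S).mp hS
    exact ⟨_, subset_rfl, h u v huv, hS.le⟩

lemma Connected.sdiam_le_card_sub_two_iff [Fintype V] (hG : G.Connected) {m : ℕ}
    (hV : Fintype.card V = m + 3) :
    sdiam G (m + 1) ≤ (m + 1 : ℕ) ↔ ∀ u v, IsCutVertex G u → IsCutVertex G v → u = v := by
  rw [sdiam_le_iff]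
  constructor
  · intro h u v hu hv
    by_contra huv
    obtain ⟨W, hSW, hW, hc⟩ := h _ ((ncard_eq_card_sub_two_iff hV _).mpr ⟨u, v, huv, rfl⟩)
    have hcase : W = {u, v}ᶜ ∨ W = {u}ᶜ ∨ W = {v}ᶜ := by
      have hne : W ≠ Set.univ := by
        rintro rfl
        rw [Set.ncard_univ, Nat.card_eq_fintype_card] at hc
        omega
      have hS : ∀ x, x ≠ u → x ≠ v → x ∈ W := fun x h1 h2 => hSW (by simp [h1, h2])
      by_cases h1 : u ∈ W <;> by_cases h2 : v ∈ W
      · exact absurd (Set.eq_univ_of_forall fun x => by grind) hne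
      · right; right; ext x; grind
      · right; left; ext x; grind
      · left; ext x; grind
    rcases hcase with rfl | rfl | rfl
    · exact (hG.induce_compl_singleton_or huv hW).elim hu hv
    · exact hu hW
    · exact hv hW
  · intro h S hS
    obtain ⟨u, v, huv, rfl⟩ := (ncard_eq_card_sub_two_iff hV S).mp hS
    have hcard : ∀ x : V, ({x}ᶜ : Set V).ncard ≤ m + 1 + 1 := by
      intro x
      have h1 := Set.ncard_add_ncard_compl ({x} : Set V)
      rw [Set.ncard_singleton, Nat.card_eq_fintype_card] at h1
      omega
    by_cases hu : (G.induce ({u}ᶜ : Set V)).Connected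
    · exact ⟨_, by simp, hu, hcard u⟩
    · by_cases hv : (G.induce ({v}ᶜ : Set V)).Connected
      · exact ⟨_, by simp, hv, hcard v⟩
      · exact absurd (h u v hu hv) huv

lemma Connected.kappa_eq_two_iff [Fintype V] (hG : G.Connected) (hV : 4 ≤ Fintype.card V) :
    kappa G = 2 ↔ (∀ v, ¬ IsCutVertex G v) ∧
      ∃ u v, u ≠ v ∧ ¬ (G.induce ({u, v}ᶜ : Set V)).Connected := by
  set K : Set ℕ := {m : ℕ | ∃ U : Set V, U ⊆ Set.univ ∧ U.ncard = m ∧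
    (¬ (G.induce (Set.univ \ U)).Connected ∨ (Set.univ \ U).ncard = 1)} with hK
  have hk : kappa G = sInf K := rfl
  have hmem : ∀ m, m ≤ 2 → (m ∈ K ↔ ∃ U : Set V, U.ncard = m ∧
      ¬ (G.induce Uᶜ).Connected) := by
    intro m hm
    simp only [hK, Set.mem_ofPred_eq, Set.subset_univ, true_and]
    refine exists_congr fun U => and_congr_right fun hU => ?_
    rw [← Set.compl_eq_univ_sdiff]
    refine or_iff_left ?_
    have h1 := Set.ncard_add_ncard_compl U
    rw [Nat.card_eq_fintype_card] at h1
    omega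
  have h0 : 0 ∉ K := by
    rw [hmem 0 (by omega)]
    rintro ⟨U, hU, h⟩
    rw [Set.ncard_eq_zero] at hU
    subst hU
    rw [Set.compl_empty] at h
    exact h ((induceUnivIso G).connected_iff.mpr hG)
  have h1 : 1 ∈ K ↔ ∃ v, IsCutVertex G v := by
    rw [hmem 1 (by omega)]
    constructor
    · rintro ⟨U, hU, h⟩
      obtain ⟨v, rfl⟩ := Set.ncard_eq_one.mp hU
      exact ⟨v, h⟩
    · rintro ⟨v, h⟩
      exact ⟨{v}, Set.ncard_singleton v, h⟩
  have h2 : 2 ∈ K ↔ ∃ u v, u ≠ v ∧ ¬ (G.induce ({u, v}ᶜ : Set V)).Connected := by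
    rw [hmem 2 le_rfl]
    constructor
    · rintro ⟨U, hU, h⟩
      obtain ⟨u, v, huv, rfl⟩ := Set.ncard_eq_two.mp hU
      exact ⟨u, v, huv, h⟩
    · rintro ⟨u, v, huv, h⟩
      exact ⟨{u, v}, Set.ncard_pair huv, h⟩
  rw [hk, ← h2, ← not_exists, ← h1]
  constructor
  · intro h
    refine ⟨Nat.notMem_of_lt_sInf (by omega), ?_⟩
    have := Nat.sInf_mem (Nat.nonempty_of_pos_sInf (s := K) (by omega))
    rwa [h] at this
  · rintro ⟨hn1, hm2⟩
    refine le_antisymm (Nat.sInf_le hm2) (le_csInf ⟨2, hm2⟩ fun b hb => ?_)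
    by_contra! hlt
    interval_cases b
    · exact h0 hb
    · exact hn1 hb

end SimpleGraph

/-- For a connected graph `G` of order `n ≥ 4`, `sdiam_{n-2}(G) = n - 2`
if and only if `κ(G) = 2` or `G` contains exactly one cut vertex. -/
theorem sdiam_sub_two_eq_iff_kappa_or_cut {V : Type*} [Fintype V] (G : SimpleGraph V)
    (hG : G.Connected) (n : ℕ) (hn : Fintype.card V = n) (hn4 : 4 ≤ n) :
    sdiam G (n - 2) = (↑(n - 2) : ℕ∞) ↔
      kappa G = 2 ∨ {v : V | IsCutVertex G v}.ncard = 1 := by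
  obtain ⟨m, rfl⟩ : ∃ m, n = m + 3 := ⟨n - 3, by omega⟩
  have h4 : 4 ≤ Fintype.card V := by omega
  have hsub : m + 3 - 2 = m + 1 := by omega
  have hle : sdiam G (m + 1) = (↑(m + 1) : ℕ∞) ↔
      sdiam G (m + 1) ≤ (m + 1 : ℕ) ∧ ¬ sdiam G (m + 1) ≤ m := by
    rw [not_le, ← ENat.add_one_le_iff (ENat.natCast_ne_top m), le_antisymm_iff]
    norm_cast
  rw [hsub, hle, hG.sdiam_le_card_sub_two_iff hn, sdiam_le_card_sub_three_iff hn,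
    hG.kappa_eq_two_iff h4, Set.ncard_eq_one]
  constructor
  · rintro ⟨huniq, hpair⟩
    by_cases hcut : ∃ v, IsCutVertex G v
    · obtain ⟨v, hv⟩ := hcut
      exact .inr ⟨v, Set.eq_singleton_iff_unique_mem.mpr ⟨hv, fun w hw => huniq w v hw hv⟩⟩
    · push Not at hcut hpair
      exact .inl ⟨hcut, hpair⟩
  · rintro (⟨hcut, u, v, huv, h⟩ | ⟨u, hu⟩)
    · exact ⟨fun x _ hx => absurd hx (hcut x), fun hall => h (hall u v huv)⟩
    · obtain ⟨hu, huniq⟩ := Set.eq_singleton_iff_unique_mem.mp hu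
      refine ⟨fun x y hx hy => (huniq x hx).trans (huniq y hy).symm, fun hall => ?_⟩
      obtain ⟨v, huv, h⟩ := exists_not_connected_induce_compl_pair h4 hu
      exact h (hall u v huv)
end
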